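/- Let f : [0,1]² → [0,1] be integrable with f(x,y) + f(y,x) ≤ 1 for all x,y, and suppose ∫₀¹ |∫₀¹ f(x,y) dx − 1/2| dy ≥ ε for some ε ≥ 0. Then for every k ≥ 2 the directed k-edge path density ∫_{[0,1]^{k+1}} f(x₀,x₁)···f(x_{k-1},x_k) dx₀···dx_k is at most 2^{-k}(1 − 2ε²). -/

import Mathlib

open MeasureTheory

section SkewPerturbation

variable {V : Type*} [AddCommGroup V] [Module ℝ V]

/-- The polynomials `Φ` in `A` with `Φ₀ = 0`, `Φ₁ = 1`, `Φᵢ₊₂ = mᵢ + A² Φᵢ`. -/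
noncomputable def skewPoly (A : V →ₗ[ℝ] V) (m : ℕ → ℝ) : ℕ → V →ₗ[ℝ] V
  | 0 => 0
  | 1 => LinearMap.id
  | (i + 2) => m i • LinearMap.id + A ∘ₗ A ∘ₗ skewPoly A m i

lemma skewPoly_comm (A : V →ₗ[ℝ] V) (m : ℕ → ℝ) (i : ℕ) (u : V) :
    skewPoly A m i (A u) = A (skewPoly A m i u) := by
  induction i using Nat.twoStepInduction with
  | zero => simp [skewPoly]
  | one => simp [skewPoly]
  | more i ih _ => simp [skewPoly, ih]

lemma skewPoly_contractive {B : LinearMap.BilinForm ℝ V} {A : V →ₗ[ℝ] V} {m : ℕ → ℝ}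
    (hsymm : ∀ u v, B u v = B v u)
    (hnonneg : ∀ u, 0 ≤ B u u)
    (hskew : ∀ u v, B (A u) v = -B u (A v))
    (hnorm : ∀ u, B (A u) (A u) ≤ 1 / 2 * B u u)
    (i : ℕ) (hm : ∀ j, j + 2 ≤ i → 1 / 2 ≤ m j ∧ m j ≤ 1) (u : V) :
    B (skewPoly A m i u) (skewPoly A m i u) ≤ B (skewPoly A m i u) u := by
  induction i using Nat.twoStepInduction generalizing u with
  | zero => simp [skewPoly]
  | one => simp [skewPoly]
  | more i ih _ =>
    have ih' := ih fun j hj => hm j (by omega)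
    obtain ⟨h1, h2⟩ := hm i (by omega)
    set o := skewPoly A m i u with ho
    have hstep : skewPoly A m (i + 2) u = m i • u + A (A o) := by simp [skewPoly, ho]
    have h3 := ih' (A u)
    rw [skewPoly_comm, ← ho] at h3
    have h4 := ih' u
    rw [← ho] at h4
    have h5 := hnorm (A o)
    have h6 := hnorm o
    have h7 : B (A (A o)) u = -B (A o) (A u) := hskew _ _
    have h8 := hnonneg (u - o)
    have h9 := hnonneg (A (A o))
    have h10 := hsymm o u
    have h11 := hsymm u (A (A o))
    rw [hstep]
    simp only [map_add, map_sub, map_smul, LinearMap.add_apply, LinearMap.sub_apply,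
      LinearMap.smul_apply, smul_eq_mul] at h8 ⊢
    rw [h11, h7]
    have h12 : B (A (A o)) (A (A o)) ≤ 1 / 4 * B u u := by linarith
    nlinarith [mul_nonneg (sub_nonneg.2 h1) (sub_nonneg.2 h3),
      mul_nonneg (sub_nonneg.2 h1) (sub_nonneg.2 h5),
      mul_nonneg (sub_nonneg.2 h1) (sub_nonneg.2 h12),
      mul_nonneg (sub_nonneg.2 h2) (sub_nonneg.2 h12),
      mul_nonneg (mul_nonneg (sub_nonneg.2 h1) (sub_nonneg.2 h2)) h9,
      mul_nonneg (mul_nonneg (sub_nonneg.2 h1) (sub_nonneg.2 h2)) (hnonneg u)]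

/-- The operator `v ↦ ⟨𝟙, v⟩ 𝟙 + A v`. -/
noncomputable def rankOneAdd (B : LinearMap.BilinForm ℝ V) (one : V) (A : V →ₗ[ℝ] V) :
    V →ₗ[ℝ] V :=
  (B one).smulRight one + A

lemma rankOneAdd_apply (B : LinearMap.BilinForm ℝ V) (one : V) (A : V →ₗ[ℝ] V) (v : V) :
    rankOneAdd B one A v = B one v • one + A v := rfl

lemma pow_adjoint {B : LinearMap.BilinForm ℝ V} {M M' : V →ₗ[ℝ] V}
    (h : ∀ u v, B (M u) v = B u (M' v)) (i : ℕ) (u v : V) :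
    B ((M ^ i) u) v = B u ((M' ^ i) v) := by
  induction i generalizing u with
  | zero => simp
  | succ i ih => rw [pow_succ, Module.End.mul_apply, ih, h, pow_succ', Module.End.mul_apply]

lemma rankOneAdd_adjoint {B : LinearMap.BilinForm ℝ V} {A : V →ₗ[ℝ] V} (one : V)
    (hsymm : ∀ u v, B u v = B v u)
    (hskew : ∀ u v, B (A u) v = -B u (A v)) (u v : V) :
    B (rankOneAdd B one A u) v = B u (rankOneAdd B one (-A) v) := by
  simp only [rankOneAdd_apply, map_add, map_smul, LinearMap.add_apply, LinearMap.smul_apply,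
    smul_eq_mul, LinearMap.neg_apply, map_neg, hskew]
  rw [hsymm u one]; ring

lemma rankOneAdd_pow_moment {B : LinearMap.BilinForm ℝ V} {A : V →ₗ[ℝ] V} (one : V)
    (hsymm : ∀ u v, B u v = B v u)
    (hskew : ∀ u v, B (A u) v = -B u (A v)) (i : ℕ) :
    B one ((rankOneAdd B one (-A) ^ i) one) = B one ((rankOneAdd B one A ^ i) one) := by
  rw [← pow_adjoint (rankOneAdd_adjoint one hsymm hskew), hsymm]

/-- Odd part of the iterates of `rankOneAdd`. -/
lemma rankOneAdd_pow_sub {B : LinearMap.BilinForm ℝ V} {A : V →ₗ[ℝ] V} (one : V)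
    (hsymm : ∀ u v, B u v = B v u)
    (hskew : ∀ u v, B (A u) v = -B u (A v)) (i : ℕ) :
    (rankOneAdd B one A ^ i) one - (rankOneAdd B one (-A) ^ i) one =
      (2 : ℝ) • skewPoly A (fun j => B one ((rankOneAdd B one A ^ j) one)) i (A one) := by
  induction i using Nat.twoStepInduction with
  | zero => simp [skewPoly]
  | one =>
    simp only [pow_one, rankOneAdd_apply, skewPoly, LinearMap.neg_apply, LinearMap.id_apply]
    module
  | more i ih _ =>
    have hA := congrArg (fun v => A (A v)) ih
    simp only [map_sub, map_smul] at hA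
    have hm := rankOneAdd_pow_moment one hsymm hskew (A := A)
    have h1 := hm (i + 1)
    have h0 := hm i
    rw [pow_succ' _ (i + 1), pow_succ' _ (i + 1), Module.End.mul_apply, Module.End.mul_apply,
      rankOneAdd_apply, rankOneAdd_apply, h1]
    simp only [pow_succ', Module.End.mul_apply, rankOneAdd_apply] at h0 ⊢
    simp only [skewPoly, LinearMap.neg_apply, map_add, map_smul, map_neg, LinearMap.add_apply,
      LinearMap.smul_apply, LinearMap.id_apply, LinearMap.comp_apply, h0]
    rw [sub_eq_iff_eq_add] at hA
    rw [hA]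
    module

/-- Even part of the iterates of `rankOneAdd`. -/
lemma rankOneAdd_pow_succ_add {B : LinearMap.BilinForm ℝ V} {A : V →ₗ[ℝ] V} (one : V)
    (hsymm : ∀ u v, B u v = B v u)
    (hskew : ∀ u v, B (A u) v = -B u (A v)) (i : ℕ) :
    (rankOneAdd B one A ^ (i + 1)) one + (rankOneAdd B one (-A) ^ (i + 1)) one =
      (2 : ℝ) • (B one ((rankOneAdd B one A ^ i) one) • one +
        A (skewPoly A (fun j => B one ((rankOneAdd B one A ^ j) one)) i (A one))) := by
  have hA := congrArg A (rankOneAdd_pow_sub one hsymm hskew i)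
  simp only [map_sub, map_smul] at hA
  rw [sub_eq_iff_eq_add] at hA
  rw [pow_succ', pow_succ', Module.End.mul_apply, Module.End.mul_apply, rankOneAdd_apply,
    rankOneAdd_apply, rankOneAdd_pow_moment one hsymm hskew, LinearMap.neg_apply, hA]
  module

lemma moment_succ {B : LinearMap.BilinForm ℝ V} {A : V →ₗ[ℝ] V} (one : V)
    (hsymm : ∀ u v, B u v = B v u)
    (hskew : ∀ u v, B (A u) v = -B u (A v))
    (hone : B one one = 1) (i : ℕ) :
    B one ((rankOneAdd B one A ^ (i + 1)) one) = B one ((rankOneAdd B one A ^ i) one) -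
      B (skewPoly A (fun j => B one ((rankOneAdd B one A ^ j) one)) i (A one)) (A one) := by
  have h := congrArg (B one) (rankOneAdd_pow_succ_add one hsymm hskew i)
  simp only [map_add, map_smul, smul_eq_mul, hone] at h
  rw [rankOneAdd_pow_moment one hsymm hskew] at h
  have h2 := hskew one (skewPoly A (fun j => B one ((rankOneAdd B one A ^ j) one)) i (A one))
  rw [hsymm (skewPoly A _ i (A one)) (A one)]
  linarith

lemma moment_antitone {B : LinearMap.BilinForm ℝ V} {A : V →ₗ[ℝ] V} (one : V)
    (hsymm : ∀ u v, B u v = B v u)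
    (hnonneg : ∀ u, 0 ≤ B u u)
    (hskew : ∀ u v, B (A u) v = -B u (A v))
    (hnorm : ∀ u, B (A u) (A u) ≤ 1 / 2 * B u u)
    (hone : B one one = 1) (k : ℕ)
    (hk : ∀ j, j + 3 ≤ k → 1 / 2 ≤ B one ((rankOneAdd B one A ^ j) one)) (i : ℕ) (hi : i < k) :
    B one ((rankOneAdd B one A ^ (i + 1)) one) ≤ B one ((rankOneAdd B one A ^ i) one) ∧
      B one ((rankOneAdd B one A ^ i) one) ≤ 1 := by
  induction i using Nat.strong_induction_on with
  | _ i ih =>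
    have hle : ∀ j ≤ i, B one ((rankOneAdd B one A ^ j) one) ≤ 1 := by
      intro j hj
      cases j with
      | zero => simp [hone]
      | succ j => exact (ih j (by omega) (by omega)).1.trans (ih j (by omega) (by omega)).2
    refine ⟨?_, hle i le_rfl⟩
    have h := skewPoly_contractive hsymm hnonneg hskew hnorm
      (m := fun j => B one ((rankOneAdd B one A ^ j) one)) i
      (fun j hj => ⟨hk j (by omega), hle j (by omega)⟩) (A one)
    rw [moment_succ one hsymm hskew hone i]
    linarith [hnonneg (skewPoly A (fun j => B one ((rankOneAdd B one A ^ j) one)) i (A one))]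

lemma le_of_defect_two {B : LinearMap.BilinForm ℝ V} {A : V →ₗ[ℝ] V} {one e : V} {n : ℝ}
    (hsymm : ∀ u v, B u v = B v u)
    (hnonneg : ∀ u, 0 ≤ B u u)
    (hskew : ∀ u v, B (A u) v = -B u (A v))
    (hone : B one one = 1)
    (hδ1 : B e one ≤ 1)
    (hn1 : n ≤ B one ((rankOneAdd B one A ^ 2) one) - B e ((rankOneAdd B one A ^ 1) one))
    (hn2 : n ≤ B one ((rankOneAdd B one A ^ 2) one) - B e ((rankOneAdd B one (-A) ^ 1) one))
    (hδ0 : 0 ≤ B e one) :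
    n ≤ 1 - (√(B (A one) (A one)) + B e one) ^ 2 / 2 := by
  have hm1 := moment_succ one hsymm hskew hone 0
  have hm2 := moment_succ one hsymm hskew hone 1
  have hadd := congrArg (B e) (rankOneAdd_pow_succ_add one hsymm hskew 0)
  simp only [skewPoly, map_add, map_smul, map_zero, LinearMap.zero_apply, smul_eq_mul, pow_zero,
    Module.End.one_apply, hone, LinearMap.id_apply, zero_add, Nat.reduceAdd] at hm1 hm2 hadd
  have hβ := Real.sq_sqrt (hnonneg (A one))
  set β := √(B (A one) (A one))
  nlinarith [sq_nonneg (β - B e one)]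

lemma le_of_defect {B : LinearMap.BilinForm ℝ V} {A : V →ₗ[ℝ] V} {one e : V} {n : ℝ}
    (hsymm : ∀ u v, B u v = B v u)
    (hnonneg : ∀ u, 0 ≤ B u u)
    (hskew : ∀ u v, B (A u) v = -B u (A v))
    (hnorm : ∀ u, B (A u) (A u) ≤ 1 / 2 * B u u)
    (hone : B one one = 1)
    (hδ0 : 0 ≤ B e one) (hδ1 : B e one ≤ 1 / 2)
    (he : ∀ v, -(B e one * √(B v v)) ≤ B e (A v)) (k : ℕ)
    (hk : ∀ j ≤ k, 1 / 2 ≤ B one ((rankOneAdd B one A ^ j) one))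
    (hn0 : n ≤ B one ((rankOneAdd B one A ^ (k + 3)) one))
    (hn1 : n ≤ B one ((rankOneAdd B one A ^ (k + 3)) one) -
      B e ((rankOneAdd B one A ^ (k + 2)) one))
    (hn2 : n ≤ B one ((rankOneAdd B one A ^ (k + 3)) one) -
      B e ((rankOneAdd B one (-A) ^ (k + 2)) one)) :
    n ≤ 1 - (√(B (A one) (A one)) + B e one) ^ 2 / 2 := by
  have hm1 := moment_succ one hsymm hskew hone 0
  have hm2 := moment_succ one hsymm hskew hone 1
  have hm3 := moment_succ one hsymm hskew hone 2
  have hadd := congrArg (B e) (rankOneAdd_pow_succ_add one hsymm hskew (k + 1))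
  have hanti := moment_antitone one hsymm hnonneg hskew hnorm hone (k + 3)
    (fun j hj => hk j (by omega))
  have hcontr := skewPoly_contractive hsymm hnonneg hskew hnorm
    (m := fun j => B one ((rankOneAdd B one A ^ j) one)) (k + 1)
    (fun j hj => ⟨hk j (by omega), (hanti j (by omega)).2⟩) (A one)
  have hle3 : ∀ i ≤ k, B one ((rankOneAdd B one A ^ (i + 3)) one) ≤
      B one ((rankOneAdd B one A ^ 3) one) := by
    intro i
    induction i with
    | zero => simp
    | succ i ih => exact fun hi => (hanti (i + 3) (by omega)).1.trans (ih (by omega))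
  have hlek := hle3 k le_rfl
  have hk1 := (hanti (k + 1) (by omega)).1
  have hk2 := (hanti (k + 2) (by omega)).1
  simp only [skewPoly, map_zero, LinearMap.zero_apply, pow_zero, Module.End.one_apply, hone,
    LinearMap.id_apply, zero_add, Nat.reduceAdd, LinearMap.add_apply, one_smul,
    LinearMap.comp_apply, sub_zero, add_zero] at hm1 hm2 hm3
  simp only [map_add, map_smul, smul_eq_mul] at hadd
  set o := skewPoly A (fun j => B one ((rankOneAdd B one A ^ j) one)) (k + 1) (A one) with ho
  have hsub := hnonneg (A one - o)
  simp only [map_sub, LinearMap.sub_apply] at hsub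
  rw [hsymm (A one) o] at hsub
  have hoβ : √(B o o) ≤ √(B (A one) (A one)) := Real.sqrt_le_sqrt (by linarith)
  have heo := he o
  have hβ := Real.sq_sqrt (hnonneg (A one))
  have hβ0 := Real.sqrt_nonneg (B (A one) (A one))
  set β := √(B (A one) (A one))
  set δ := B e one
  set mk := B one ((rankOneAdd B one A ^ (k + 3)) one)
  set mk1 := B one ((rankOneAdd B one A ^ (k + 1)) one)
  have heo' : -(δ * β) ≤ B e (A o) := by nlinarith
  have hmk : mk ≤ 1 - 2 * β ^ 2 := by linarith
  have hn : n ≤ mk - δ * mk1 - B e (A o) := by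
    rw [show k + 1 + 1 = k + 2 from rfl] at hadd; linarith
  have hmk1 : mk ≤ mk1 := hk2.trans hk1
  have hq : n ≤ mk * (1 - δ) + δ * β := by nlinarith
  have hq2 : n ≤ (1 - 2 * β ^ 2) * (1 - δ) + δ * β := by nlinarith
  rcases le_total δ β with h | h
  · nlinarith
  · have hβh : β ≤ 1 / 2 := h.trans hδ1
    nlinarith [mul_nonneg (sub_nonneg.2 hδ1) hδ0, mul_nonneg (sub_nonneg.2 hδ1) (sq_nonneg β),
      mul_nonneg (sub_nonneg.2 hβh) hδ0, mul_nonneg (sub_nonneg.2 hβh) (sub_nonneg.2 hδ1),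
      mul_nonneg hβ0 (sub_nonneg.2 h), mul_nonneg hβ0 hδ0]

end SkewPerturbation

section Kernel

variable {Ω : Type*} [MeasurableSpace Ω]

/-- The algebra of bounded measurable real functions. -/
def bddMeasSubalgebra (Ω : Type*) [MeasurableSpace Ω] : Subalgebra ℝ (Ω → ℝ) where
  carrier := {u | Measurable u ∧ ∃ C, ∀ x, |u x| ≤ C}
  mul_mem' := by
    rintro u v ⟨hu, C, hC⟩ ⟨hv, D, hD⟩
    refine ⟨hu.mul hv, C * D, fun x => ?_⟩
    rw [Pi.mul_apply, abs_mul]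
    exact mul_le_mul (hC x) (hD x) (abs_nonneg _) ((abs_nonneg _).trans (hC x))
  add_mem' := by
    rintro u v ⟨hu, C, hC⟩ ⟨hv, D, hD⟩
    exact ⟨hu.add hv, C + D, fun x => (abs_add_le _ _).trans (add_le_add (hC x) (hD x))⟩
  algebraMap_mem' r := ⟨measurable_const, |r|, fun _ => le_rfl⟩

/-- Bounded measurable real functions. -/
abbrev BddMeas (Ω : Type*) [MeasurableSpace Ω] : Type _ := bddMeasSubalgebra Ω

lemma BddMeas.measurable (u : BddMeas Ω) : Measurable (u : Ω → ℝ) := u.2.1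

lemma BddMeas.integrable (u : BddMeas Ω) (μ : Measure Ω) [IsFiniteMeasure μ] :
    Integrable (u : Ω → ℝ) μ := by
  obtain ⟨C, hC⟩ := u.2.2
  exact Integrable.of_bound u.measurable.aestronglyMeasurable C (.of_forall hC)

/-- Composition with a measurable map. -/
def BddMeas.comp {Ω' : Type*} [MeasurableSpace Ω'] (u : BddMeas Ω) (φ : Ω' → Ω)
    (hφ : Measurable φ) : BddMeas Ω' :=
  ⟨fun x => (u : Ω → ℝ) (φ x), u.2.1.comp hφ, u.2.2.imp fun _ h _ => h _⟩

@[simp] lemma BddMeas.comp_apply {Ω' : Type*} [MeasurableSpace Ω'] (u : BddMeas Ω) (φ : Ω' → Ω)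
    (hφ : Measurable φ) (x : Ω') : (u.comp φ hφ : Ω' → ℝ) x = (u : Ω → ℝ) (φ x) := rfl

variable (μ : Measure Ω) [IsProbabilityMeasure μ]

/-- The `L²` inner product on bounded measurable functions. -/
noncomputable def bddInner : LinearMap.BilinForm ℝ (BddMeas Ω) :=
  LinearMap.mk₂ ℝ (fun u v => ∫ x, (u : Ω → ℝ) x * (v : Ω → ℝ) x ∂μ)
    (fun u u' v => by
      simp only [Subalgebra.coe_add, Pi.add_apply, add_mul]
      exact integral_add ((u * v).integrable μ) ((u' * v).integrable μ))
    (fun c u v => by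
      simp only [Subalgebra.coe_smul, Pi.smul_apply, smul_eq_mul, mul_assoc]
      exact integral_const_mul _ _)
    (fun u v v' => by
      simp only [Subalgebra.coe_add, Pi.add_apply, mul_add]
      exact integral_add ((u * v).integrable μ) ((u * v').integrable μ))
    (fun c u v => by
      simp only [Subalgebra.coe_smul, Pi.smul_apply, smul_eq_mul, mul_left_comm _ c]
      exact integral_const_mul _ _)

lemma bddInner_apply (u v : BddMeas Ω) :
    bddInner μ u v = ∫ x, (u : Ω → ℝ) x * (v : Ω → ℝ) x ∂μ := rfl

lemma bddInner_one_left (u : BddMeas Ω) : bddInner μ 1 u = ∫ x, (u : Ω → ℝ) x ∂μ := by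
  simp [bddInner_apply]

lemma bddInner_symm (u v : BddMeas Ω) : bddInner μ u v = bddInner μ v u := by
  simp only [bddInner_apply, mul_comm]

lemma bddInner_self_nonneg (u : BddMeas Ω) : 0 ≤ bddInner μ u u :=
  integral_nonneg fun _ => mul_self_nonneg _

lemma bddInner_mono_right {u v w : BddMeas Ω} (hu : ∀ x, 0 ≤ (u : Ω → ℝ) x)
    (hvw : ∀ x, (v : Ω → ℝ) x ≤ (w : Ω → ℝ) x) : bddInner μ u v ≤ bddInner μ u w :=
  integral_mono ((u * v).integrable μ) ((u * w).integrable μ)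
    fun x => mul_le_mul_of_nonneg_left (hvw x) (hu x)

lemma integrable_section (K : BddMeas (Ω × Ω)) (u : BddMeas Ω) (y : Ω) :
    Integrable (fun x => (K : Ω × Ω → ℝ) (x, y) * (u : Ω → ℝ) x) μ :=
  (K.comp (fun x => (x, y)) (by fun_prop) * u).integrable μ

/-- The integral operator `u ↦ ∫ K(x, ·) u(x) dx` as a bilinear map. -/
noncomputable def kernelOp : BddMeas (Ω × Ω) →ₗ[ℝ] BddMeas Ω →ₗ[ℝ] BddMeas Ω :=
  LinearMap.mk₂ ℝ
    (fun K u => ⟨fun y => ∫ x, (K : Ω × Ω → ℝ) (x, y) * (u : Ω → ℝ) x ∂μ, by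
      constructor
      · exact (StronglyMeasurable.integral_prod_left' (μ := μ)
          (K * u.comp Prod.fst measurable_fst).measurable.stronglyMeasurable).measurable
      · obtain ⟨C, hC⟩ := (K * u.comp Prod.fst measurable_fst).2.2
        refine ⟨C, fun y => ?_⟩
        have h := norm_integral_le_of_norm_le_const (μ := μ)
          (f := fun x => (K : Ω × Ω → ℝ) (x, y) * (u : Ω → ℝ) x) (C := C)
          (.of_forall fun x => hC (x, y))
        simpa using h⟩)
    (fun K L u => Subtype.ext <| funext fun y => by
      simp only [Subalgebra.coe_add, Pi.add_apply, add_mul]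
      exact integral_add (integrable_section μ K u y) (integrable_section μ L u y))
    (fun c K u => Subtype.ext <| funext fun y => by
      simp only [Subalgebra.coe_smul, Pi.smul_apply, smul_eq_mul, mul_assoc]
      exact integral_const_mul _ _)
    (fun K u v => Subtype.ext <| funext fun y => by
      simp only [Subalgebra.coe_add, Pi.add_apply, mul_add]
      exact integral_add (integrable_section μ K u y) (integrable_section μ K v y))
    (fun c K u => Subtype.ext <| funext fun y => by
      simp only [Subalgebra.coe_smul, Pi.smul_apply, smul_eq_mul, mul_left_comm _ c]
      exact integral_const_mul _ _)

lemma kernelOp_apply (K : BddMeas (Ω × Ω)) (u : BddMeas Ω) (y : Ω) :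
    (kernelOp μ K u : Ω → ℝ) y = ∫ x, (K : Ω × Ω → ℝ) (x, y) * (u : Ω → ℝ) x ∂μ := rfl

/-- The transposed kernel. -/
def BddMeas.swap (K : BddMeas (Ω × Ω)) : BddMeas (Ω × Ω) := K.comp Prod.swap measurable_swap

lemma bddInner_kernelOp (K : BddMeas (Ω × Ω)) (u v : BddMeas Ω) :
    bddInner μ (kernelOp μ K u) v = ∫ p, (K * u.comp Prod.fst measurable_fst *
      v.comp Prod.snd measurable_snd : BddMeas (Ω × Ω)).1 p ∂(μ.prod μ) := by
  rw [integral_prod_symm _ (BddMeas.integrable _ _), bddInner_apply]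
  refine integral_congr_ae (.of_forall fun y => ?_)
  simp only [kernelOp_apply]
  rw [← integral_mul_const]
  rfl

lemma bddInner_kernelOp_swap (K : BddMeas (Ω × Ω)) (u v : BddMeas Ω) :
    bddInner μ (kernelOp μ K u) v = bddInner μ u (kernelOp μ K.swap v) := by
  rw [bddInner_symm μ u, bddInner_kernelOp, bddInner_kernelOp, ← integral_prod_swap]
  refine integral_congr_ae (.of_forall fun p => ?_)
  change (K : Ω × Ω → ℝ) p.swap * (u : Ω → ℝ) p.2 * (v : Ω → ℝ) p.1 =
    (K : Ω × Ω → ℝ) p.swap * (v : Ω → ℝ) p.1 * (u : Ω → ℝ) p.2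
  ring

lemma kernelOp_nonneg {K : BddMeas (Ω × Ω)} (hK : ∀ p, 0 ≤ (K : Ω × Ω → ℝ) p) {u : BddMeas Ω}
    (hu : ∀ x, 0 ≤ (u : Ω → ℝ) x) (y : Ω) : 0 ≤ (kernelOp μ K u : Ω → ℝ) y :=
  integral_nonneg fun x => mul_nonneg (hK _) (hu x)

lemma kernelOp_mono {K L : BddMeas (Ω × Ω)} (hK : ∀ p, 0 ≤ (K : Ω × Ω → ℝ) p)
    (hKL : ∀ p, (K : Ω × Ω → ℝ) p ≤ (L : Ω × Ω → ℝ) p) {u v : BddMeas Ω}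
    (hv : ∀ x, 0 ≤ (v : Ω → ℝ) x)
    (huv : ∀ x, (u : Ω → ℝ) x ≤ (v : Ω → ℝ) x) (y : Ω) :
    (kernelOp μ K u : Ω → ℝ) y ≤ (kernelOp μ L v : Ω → ℝ) y :=
  integral_mono (integrable_section μ K u y) (integrable_section μ L v y) fun x =>
    (mul_le_mul_of_nonneg_left (huv x) (hK _)).trans (mul_le_mul_of_nonneg_right (hKL _) (hv x))

lemma kernelOp_pow_nonneg {K : BddMeas (Ω × Ω)} (hK : ∀ p, 0 ≤ (K : Ω × Ω → ℝ) p) {u : BddMeas Ω}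
    (hu : ∀ x, 0 ≤ (u : Ω → ℝ) x) (i : ℕ) (y : Ω) :
    0 ≤ (((kernelOp μ K) ^ i) u : Ω → ℝ) y := by
  induction i generalizing y with
  | zero => exact hu y
  | succ i ih => rw [pow_succ', Module.End.mul_apply]; exact kernelOp_nonneg μ hK ih y

lemma kernelOp_pow_mono {K L : BddMeas (Ω × Ω)} (hK : ∀ p, 0 ≤ (K : Ω × Ω → ℝ) p)
    (hKL : ∀ p, (K : Ω × Ω → ℝ) p ≤ (L : Ω × Ω → ℝ) p) {u v : BddMeas Ω}
    (hv : ∀ x, 0 ≤ (v : Ω → ℝ) x)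
    (huv : ∀ x, (u : Ω → ℝ) x ≤ (v : Ω → ℝ) x) (i : ℕ) (y : Ω) :
    (((kernelOp μ K) ^ i) u : Ω → ℝ) y ≤ (((kernelOp μ L) ^ i) v : Ω → ℝ) y := by
  induction i generalizing y with
  | zero => exact huv y
  | succ i ih =>
    rw [pow_succ', pow_succ', Module.End.mul_apply, Module.End.mul_apply]
    exact kernelOp_mono μ hK hKL (kernelOp_pow_nonneg μ (fun p => (hK p).trans (hKL p)) hv i) ih y

/-- Concatenating walks: joining the two pieces by an edge of weight at most `c`. -/
lemma walk_submultiplicative {K : BddMeas (Ω × Ω)} (hK : ∀ p, 0 ≤ (K : Ω × Ω → ℝ) p) {c : ℝ}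
    (hKc : ∀ p, (K : Ω × Ω → ℝ) p ≤ c) (i j : ℕ) :
    bddInner μ 1 (((kernelOp μ K) ^ (i + 1 + j)) 1) ≤
      c * bddInner μ 1 (((kernelOp μ K) ^ i) 1) * bddInner μ 1 (((kernelOp μ K) ^ j) 1) := by
  have h0 : ∀ x, (0 : ℝ) ≤ ((1 : BddMeas Ω) : Ω → ℝ) x := fun _ => zero_le_one
  set w := ((kernelOp μ K) ^ j) 1 with hw
  have hwn : ∀ x, 0 ≤ (w : Ω → ℝ) x := kernelOp_pow_nonneg μ hK h0 j
  have hs : 0 ≤ bddInner μ 1 w := by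
    rw [bddInner_one_left]; exact integral_nonneg hwn
  obtain hΩ | hΩ := isEmpty_or_nonempty Ω
  · exact absurd (measure_univ (μ := μ)) (by simp [Measure.eq_zero_of_isEmpty μ])
  have hc : 0 ≤ c := (hK (Classical.arbitrary _)).trans (hKc (Classical.arbitrary _))
  have h1 : ∀ y, (kernelOp μ K w : Ω → ℝ) y ≤ (((c * bddInner μ 1 w) • (1 : BddMeas Ω) :
      BddMeas Ω) : Ω → ℝ) y := by
    intro y
    have h2 : (((c * bddInner μ 1 w) • (1 : BddMeas Ω) : BddMeas Ω) : Ω → ℝ) y =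
      c * bddInner μ 1 w := by simp
    rw [h2, bddInner_one_left, ← integral_const_mul]
    exact integral_mono (integrable_section μ K w y) ((w.integrable μ).const_mul c)
      fun x => mul_le_mul_of_nonneg_right (hKc _) (hwn x)
  have h3 : ∀ y, (0 : ℝ) ≤ (((c * bddInner μ 1 w) • (1 : BddMeas Ω) : BddMeas Ω) : Ω → ℝ) y :=
    fun y => (kernelOp_nonneg μ hK hwn y).trans (h1 y)
  have h4 := bddInner_mono_right μ h0 (kernelOp_pow_mono μ hK (fun p => le_rfl) h3 h1 i)
  rw [map_smul, map_smul, smul_eq_mul] at h4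
  rw [pow_add, pow_succ, Module.End.mul_apply, Module.End.mul_apply, ← hw]
  linarith

lemma sq_integral_le (u : BddMeas Ω) :
    (∫ x, (u : Ω → ℝ) x ∂μ) ^ 2 ≤ bddInner μ u u := by
  have h := bddInner_self_nonneg μ (u - (bddInner μ 1 u) • 1)
  have h1 : bddInner μ (1 : BddMeas Ω) 1 = 1 := by simp [bddInner_apply]
  simp only [map_sub, map_smul, LinearMap.sub_apply, LinearMap.smul_apply, smul_eq_mul, h1,
    bddInner_symm μ u 1] at h
  rw [← bddInner_one_left]
  nlinarith

lemma kernelOp_norm_le_of_antisymm {K : BddMeas (Ω × Ω)} (hK : K.swap = -K)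
    (hK1 : ∀ p, |(K : Ω × Ω → ℝ) p| ≤ 1) (u : BddMeas Ω) :
    bddInner μ (kernelOp μ K u) (kernelOp μ K u) ≤ 1 / 2 * bddInner μ u u := by
  set v := kernelOp μ K u with hv
  set c := bddInner μ v v with hc
  have hc0 : 0 ≤ c := bddInner_self_nonneg μ v
  let P : BddMeas Ω → BddMeas Ω → BddMeas (Ω × Ω) := fun a b =>
    a.comp Prod.fst measurable_fst * b.comp Prod.snd measurable_snd
  have hP : ∀ a b, ∫ p, (P a b : Ω × Ω → ℝ) p ∂(μ.prod μ) =
      (∫ x, (a : Ω → ℝ) x ∂μ) * ∫ x, (b : Ω → ℝ) x ∂μ := fun a b =>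
    integral_prod_mul (μ := μ) (ν := μ) (a : Ω → ℝ) (b : Ω → ℝ)
  have h1 : ∫ p, (K * P u v : BddMeas (Ω × Ω)).1 p ∂(μ.prod μ) = c := by
    rw [hc, hv, ← hv, hv, bddInner_kernelOp, ← hv, mul_assoc]
  have h2 : ∫ p, (K * P v u : BddMeas (Ω × Ω)).1 p ∂(μ.prod μ) = -c := by
    have := bddInner_kernelOp μ K v u
    rw [bddInner_kernelOp_swap, hK, map_neg, LinearMap.neg_apply, ← hv, map_neg, ← hc,
      mul_assoc] at this
    exact this.symm
  have h3 := bddInner_mono_right (μ.prod μ) (u := 1)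
    (v := (4 * c) • (K * P u v) - (4 * c) • (K * P v u))
    (w := (4 * c ^ 2) • 1 + P (u * u) (v * v) + P (v * v) (u * u) - (2 : ℝ) • P (u * v) (u * v))
    (fun _ => zero_le_one) fun p => by
      change 4 * c * ((K : Ω × Ω → ℝ) p * ((u : Ω → ℝ) p.1 * (v : Ω → ℝ) p.2)) -
        4 * c * ((K : Ω × Ω → ℝ) p * ((v : Ω → ℝ) p.1 * (u : Ω → ℝ) p.2)) ≤
        4 * c ^ 2 * 1 + ((u : Ω → ℝ) p.1 * (u : Ω → ℝ) p.1) * ((v : Ω → ℝ) p.2 * (v : Ω → ℝ) p.2)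
        + ((v : Ω → ℝ) p.1 * (v : Ω → ℝ) p.1) * ((u : Ω → ℝ) p.2 * (u : Ω → ℝ) p.2)
        - 2 * (((u : Ω → ℝ) p.1 * (v : Ω → ℝ) p.1) * ((u : Ω → ℝ) p.2 * (v : Ω → ℝ) p.2))
      have hk := (sq_le_one_iff_abs_le_one _).2 (hK1 p)
      have h5 := mul_nonneg (sub_nonneg.2 hk) (sq_nonneg c)
      have h6 := sq_nonneg (2 * c * (K : Ω × Ω → ℝ) p -
        ((u : Ω → ℝ) p.1 * (v : Ω → ℝ) p.2 - (v : Ω → ℝ) p.1 * (u : Ω → ℝ) p.2))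
      linarith
  simp only [map_add, map_sub, map_smul, smul_eq_mul, bddInner_one_left, h1, h2, hP] at h3
  have hu : ∫ x, ((u * u : BddMeas Ω) : Ω → ℝ) x ∂μ = bddInner μ u u := rfl
  have hvv : ∫ x, ((v * v : BddMeas Ω) : Ω → ℝ) x ∂μ = c := rfl
  rw [hu, hvv] at h3
  simp only [Subalgebra.coe_one, Pi.one_apply, integral_const, probReal_univ, smul_eq_mul,
    mul_one] at h3
  rcases hc0.eq_or_lt with h | h
  · rw [← h]; have := bddInner_self_nonneg μ u; linarith
  · have := mul_self_nonneg (∫ x, ((u * v : BddMeas Ω) : Ω → ℝ) x ∂μ)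
    by_contra! hcon
    nlinarith [mul_pos h (sub_pos.2 hcon)]

end Kernel

section WalkDensity

variable {Ω : Type*} [MeasurableSpace Ω] (μ : Measure Ω) [IsProbabilityMeasure μ]

lemma rankOneAdd_kernelOp (K : BddMeas (Ω × Ω)) :
    rankOneAdd (bddInner μ) 1 (kernelOp μ K) = kernelOp μ (1 + K) := by
  have h : kernelOp μ 1 = (bddInner μ 1).smulRight 1 := by
    refine LinearMap.ext fun u => Subtype.ext <| funext fun y => ?_
    simp [kernelOp_apply, bddInner_one_left]
  rw [map_add, h, rankOneAdd]

lemma walkDensity_le_sub (K E : BddMeas (Ω × Ω)) (hK : ∀ p, 0 ≤ (K : Ω × Ω → ℝ) p)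
    (hE : ∀ p, 0 ≤ (E : Ω × Ω → ℝ) p) (hEs : E.swap = E) (k : ℕ) :
    bddInner μ 1 ((kernelOp μ K ^ (k + 1)) 1) ≤ bddInner μ 1 ((kernelOp μ (K + E) ^ (k + 1)) 1) -
      bddInner μ (kernelOp μ E 1) ((kernelOp μ (K + E) ^ k) 1) := by
  have hone : ∀ x, (0 : ℝ) ≤ ((1 : BddMeas Ω) : Ω → ℝ) x := fun _ => zero_le_one
  have hle : ∀ p, (K : Ω × Ω → ℝ) p ≤ (K + E : BddMeas (Ω × Ω)).1 p := fun p =>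
    le_add_of_nonneg_right (hE p)
  have hpos := kernelOp_pow_nonneg μ (fun p => (hK p).trans (hle p)) hone k
  have h := bddInner_mono_right μ hone (kernelOp_mono μ hK (fun p => le_rfl) hpos
    (kernelOp_pow_mono μ hK hle hone (fun _ => le_rfl) k))
  rw [pow_succ', pow_succ', Module.End.mul_apply, Module.End.mul_apply,
    bddInner_kernelOp_swap μ E, hEs]
  set v := (kernelOp μ (K + E) ^ k) 1
  rw [map_add, LinearMap.add_apply, map_add]
  linarith

lemma walkDensity_le_sub_swap (K E : BddMeas (Ω × Ω)) (hK : ∀ p, 0 ≤ (K : Ω × Ω → ℝ) p)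
    (hE : ∀ p, 0 ≤ (E : Ω × Ω → ℝ) p) (k : ℕ) :
    bddInner μ 1 ((kernelOp μ K ^ (k + 1)) 1) ≤ bddInner μ 1 ((kernelOp μ (K + E) ^ (k + 1)) 1) -
      bddInner μ (kernelOp μ E 1) ((kernelOp μ (K + E).swap ^ k) 1) := by
  have hone : ∀ x, (0 : ℝ) ≤ ((1 : BddMeas Ω) : Ω → ℝ) x := fun _ => zero_le_one
  have hle : ∀ p, (K : Ω × Ω → ℝ) p ≤ (K + E : BddMeas (Ω × Ω)).1 p := fun p =>
    le_add_of_nonneg_right (hE p)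
  have h := bddInner_mono_right μ hone (kernelOp_pow_mono μ hK hle
    (kernelOp_nonneg μ hK hone) (fun _ => le_rfl) k)
  rw [← pow_adjoint (bddInner_kernelOp_swap μ (K + E)), bddInner_symm μ _ 1, pow_succ, pow_succ,
    Module.End.mul_apply, Module.End.mul_apply]
  have h2 : kernelOp μ K 1 = kernelOp μ (K + E) 1 - kernelOp μ E 1 := by
    rw [map_add, LinearMap.add_apply, add_sub_cancel_right]
  nth_rewrite 2 [h2] at h
  rwa [map_sub, map_sub] at h

lemma neg_le_bddInner_kernelOp {K : BddMeas (Ω × Ω)} (hK : ∀ p, |(K : Ω × Ω → ℝ) p| ≤ 1)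
    {e : BddMeas Ω} (he : ∀ x, 0 ≤ (e : Ω → ℝ) x) (v : BddMeas Ω) :
    -(bddInner μ e 1 * √(bddInner μ v v)) ≤ bddInner μ e (kernelOp μ K v) := by
  have h : ∀ y, -√(bddInner μ v v) ≤ (kernelOp μ K v : Ω → ℝ) y := by
    intro y
    refine (abs_le.1 (Real.abs_le_sqrt ?_)).1
    refine (sq_integral_le μ (K.comp (fun x => (x, y)) (by fun_prop) * v)).trans ?_
    refine integral_mono ((_ * _ : BddMeas Ω).integrable μ) ((v * v).integrable μ) fun x => ?_
    change (K : Ω × Ω → ℝ) (x, y) * (v : Ω → ℝ) x * ((K : Ω × Ω → ℝ) (x, y) * (v : Ω → ℝ) x) ≤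
      (v : Ω → ℝ) x * (v : Ω → ℝ) x
    have hk := (sq_le_one_iff_abs_le_one _).2 (hK (x, y))
    nlinarith [mul_nonneg (sub_nonneg.2 hk) (mul_self_nonneg ((v : Ω → ℝ) x))]
  have h2 := bddInner_mono_right μ he (v := (-√(bddInner μ v v)) • 1) (w := kernelOp μ K v)
    fun y => by simpa using h y
  rw [map_smul, smul_eq_mul] at h2
  linarith

lemma deviation_le {a E : BddMeas (Ω × Ω)} {F : BddMeas (Ω × Ω)}
    (hF : (2 : ℝ) • F + E = 1 + a) (hE : ∀ p, 0 ≤ (E : Ω × Ω → ℝ) p) :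
    2 * ∫ y, |(∫ x, (F : Ω × Ω → ℝ) (x, y) ∂μ) - 1 / 2| ∂μ ≤
      √(bddInner μ (kernelOp μ a 1) (kernelOp μ a 1)) + bddInner μ (kernelOp μ E 1) 1 := by
  set g := kernelOp μ a 1 with hg
  set e := kernelOp μ E 1 with he
  have habs : ∃ w : BddMeas Ω, ∀ x, (w : Ω → ℝ) x = |(g : Ω → ℝ) x| :=
    ⟨⟨fun x => |(g : Ω → ℝ) x|, g.measurable.abs, g.2.2.imp fun _ h x => by simpa using h x⟩,
      fun _ => rfl⟩
  obtain ⟨w, hw⟩ := habs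
  have hepos : ∀ x, 0 ≤ (e : Ω → ℝ) x := kernelOp_nonneg μ hE fun _ => zero_le_one
  have hpt : ∀ y, (∫ x, (F : Ω × Ω → ℝ) (x, y) ∂μ) - 1 / 2 =
      1 / 2 * ((g : Ω → ℝ) y - (e : Ω → ℝ) y) := by
    intro y
    have h1 := congrArg (fun K => (kernelOp μ K 1 : Ω → ℝ) y) hF
    simp only [map_add, map_smul, LinearMap.add_apply, LinearMap.smul_apply, ← hg, ← he,
      Subalgebra.coe_add, Subalgebra.coe_smul, Pi.add_apply, Pi.smul_apply, smul_eq_mul] at h1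
    simp only [kernelOp_apply, Subalgebra.coe_one, Pi.one_apply, mul_one, integral_const,
      probReal_univ, smul_eq_mul] at h1
    linarith
  have hsq : bddInner μ w w = bddInner μ g g := by
    simp only [bddInner_apply, hw, abs_mul_abs_self]
  have h2 : ∫ y, |(∫ x, (F : Ω × Ω → ℝ) (x, y) ∂μ) - 1 / 2| ∂μ ≤
      bddInner μ 1 ((1 / 2 : ℝ) • (w + e)) := by
    rw [bddInner_one_left]
    simp only [hpt]
    refine integral_mono_of_nonneg (.of_forall fun _ => abs_nonneg _)
      (BddMeas.integrable _ _) (.of_forall fun y => ?_)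
    change |1 / 2 * ((g : Ω → ℝ) y - (e : Ω → ℝ) y)| ≤ 1 / 2 * ((w : Ω → ℝ) y + (e : Ω → ℝ) y)
    rw [hw, abs_mul, abs_of_pos (by norm_num : (0 : ℝ) < 1 / 2)]
    have := abs_sub ((g : Ω → ℝ) y) ((e : Ω → ℝ) y)
    rw [abs_of_nonneg (hepos y)] at this
    linarith
  have h3 : bddInner μ 1 w ≤ √(bddInner μ g g) := by
    rw [← hsq, bddInner_one_left]
    exact Real.le_sqrt_of_sq_le (sq_integral_le μ w)
  rw [map_smul, map_add, smul_eq_mul, bddInner_symm μ 1 e] at h2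
  linarith

theorem walkDensity_stability {F : BddMeas (Ω × Ω)} (hF0 : ∀ p, 0 ≤ (F : Ω × Ω → ℝ) p)
    (hanti : ∀ p, (F : Ω × Ω → ℝ) p + (F : Ω × Ω → ℝ) p.swap ≤ 1) {ε : ℝ} (hε : 0 ≤ ε)
    (hdev : ε ≤ ∫ y, |(∫ x, (F : Ω × Ω → ℝ) (x, y) ∂μ) - 1 / 2| ∂μ) (k : ℕ) (hk : 2 ≤ k) :
    bddInner μ 1 ((kernelOp μ ((2 : ℝ) • F) ^ k) 1) ≤ 1 - 2 * ε ^ 2 := by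
  set N : BddMeas (Ω × Ω) := (2 : ℝ) • F with hN
  set a : BddMeas (Ω × Ω) := F - F.swap with ha
  set E : BddMeas (Ω × Ω) := 1 - F - F.swap with hE
  set A := kernelOp μ a with hA
  set e := kernelOp μ E 1 with he
  have hNE : N + E = 1 + a := by rw [hN, hE, ha]; module
  have hN0 : ∀ p, 0 ≤ (N : Ω × Ω → ℝ) p := fun p => mul_nonneg zero_le_two (hF0 p)
  have hF1 : ∀ p, (F : Ω × Ω → ℝ) p ≤ 1 := fun p => by linarith [hanti p, hF0 p.swap]
  have hN2 : ∀ p, (N : Ω × Ω → ℝ) p ≤ 2 := fun p => by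
    change 2 * (F : Ω × Ω → ℝ) p ≤ 2
    linarith [hF1 p]
  have hE0 : ∀ p, 0 ≤ (E : Ω × Ω → ℝ) p := fun p => by
    change 0 ≤ 1 - (F : Ω × Ω → ℝ) p - (F : Ω × Ω → ℝ) p.swap
    linarith [hanti p]
  have hEs : E.swap = E := Subtype.ext <| funext fun p => by
    change 1 - (F : Ω × Ω → ℝ) p.swap - (F : Ω × Ω → ℝ) p =
      1 - (F : Ω × Ω → ℝ) p - (F : Ω × Ω → ℝ) p.swap
    ring
  have has : a.swap = -a := Subtype.ext <| funext fun p => by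
    change (F : Ω × Ω → ℝ) p.swap - (F : Ω × Ω → ℝ) p =
      -((F : Ω × Ω → ℝ) p - (F : Ω × Ω → ℝ) p.swap)
    ring
  have ha1 : ∀ p, |(a : Ω × Ω → ℝ) p| ≤ 1 := fun p => by
    change |(F : Ω × Ω → ℝ) p - (F : Ω × Ω → ℝ) p.swap| ≤ 1
    rw [abs_le]
    constructor <;> linarith [hF0 p, hF0 p.swap, hF1 p, hF1 p.swap]
  have hsymm := bddInner_symm μ
  have hnonneg := bddInner_self_nonneg μ
  have hskew : ∀ u v, bddInner μ (A u) v = -bddInner μ u (A v) := fun u v => by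
    rw [hA, bddInner_kernelOp_swap, has, map_neg, LinearMap.neg_apply, map_neg]
  have hnorm : ∀ u, bddInner μ (A u) (A u) ≤ 1 / 2 * bddInner μ u u :=
    kernelOp_norm_le_of_antisymm μ has ha1
  have hone : bddInner μ (1 : BddMeas Ω) 1 = 1 := by simp [bddInner_apply]
  have hM : kernelOp μ (N + E) = rankOneAdd (bddInner μ) 1 A := by
    rw [hNE, ← rankOneAdd_kernelOp]
  have hM' : kernelOp μ (N + E).swap = rankOneAdd (bddInner μ) 1 (-A) := by
    have h : (N + E).swap = 1 + -a := by rw [← has, hNE]; rfl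
    rw [h, ← rankOneAdd_kernelOp, map_neg]
  have hδ0 : 0 ≤ bddInner μ e 1 := by
    rw [bddInner_symm, bddInner_one_left]
    exact integral_nonneg (kernelOp_nonneg μ hE0 fun _ => zero_le_one)
  have hn1 := walkDensity_le_sub μ N E hN0 hE0 hEs
  have hn2 := walkDensity_le_sub_swap μ N E hN0 hE0
  have hn0 : ∀ i, bddInner μ 1 ((kernelOp μ N ^ i) 1) ≤
      bddInner μ 1 ((kernelOp μ (N + E) ^ i) 1) := fun i =>
    bddInner_mono_right μ (fun _ => zero_le_one) (kernelOp_pow_mono μ hN0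
      (fun p => le_add_of_nonneg_right (hE0 p)) (fun _ => zero_le_one) (fun _ => le_rfl) i)
  rw [hM'] at hn2
  rw [hM] at hn0 hn1 hn2
  have hpos : ∀ i, 0 ≤ bddInner μ 1 ((kernelOp μ N ^ i) 1) := fun i => by
    rw [bddInner_one_left]
    exact integral_nonneg (kernelOp_pow_nonneg μ hN0 (fun _ => zero_le_one) i)
  have hm1 := moment_succ (1 : BddMeas Ω) hsymm hskew hone 0
  simp only [skewPoly, pow_zero, Module.End.one_apply, hone, LinearMap.zero_apply, map_zero,
    sub_zero, zero_add] at hm1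
  have hN1 := hn1 0
  simp only [pow_zero, Module.End.one_apply, zero_add, hm1, ← he] at hN1
  have hδ1 : bddInner μ e 1 ≤ 1 := by
    have := hpos 1
    linarith
  have hsub : ∀ i j, bddInner μ 1 ((kernelOp μ N ^ i) 1) ≤ 1 / 2 →
      bddInner μ 1 ((kernelOp μ N ^ (i + 1 + j)) 1) ≤ bddInner μ 1 ((kernelOp μ N ^ j) 1) := by
    intro i j hi
    have := walk_submultiplicative μ hN0 hN2 i j
    nlinarith [hpos j]
  have hdev2 := (mul_le_mul_of_nonneg_left hdev zero_le_two).trans (deviation_le μ hNE hE0)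
  have htarget : 1 - (√(bddInner μ (A 1) (A 1)) + bddInner μ e 1) ^ 2 / 2 ≤ 1 - 2 * ε ^ 2 := by
    nlinarith
  have hεhalf : ε ≤ 1 / 2 := by
    refine hdev.trans ?_
    have h := integral_mono_of_nonneg (μ := μ) (g := fun _ => (1 / 2 : ℝ))
      (f := fun y => |(∫ x, (F : Ω × Ω → ℝ) (x, y) ∂μ) - 1 / 2|)
      (.of_forall fun _ => abs_nonneg _) (integrable_const _) (.of_forall fun y => ?_)
    · simpa using h
    · have h0 : 0 ≤ ∫ x, (F : Ω × Ω → ℝ) (x, y) ∂μ := integral_nonneg fun x => hF0 _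
      have h1 : ∫ x, (F : Ω × Ω → ℝ) (x, y) ∂μ ≤ ∫ _, (1 : ℝ) ∂μ :=
        integral_mono ((F.comp (fun x => (x, y)) (by fun_prop)).integrable μ)
          (integrable_const _) fun x => hF1 _
      simp only [integral_const, probReal_univ, smul_eq_mul, one_mul] at h1
      simp only [abs_le]
      constructor <;> linarith
  have hhalf : 1 / 2 ≤ 1 - 2 * ε ^ 2 := by nlinarith
  induction k using Nat.strong_induction_on with
  | _ k ih =>
    obtain rfl | ⟨k, rfl⟩ : k = 2 ∨ ∃ l, k = l + 3 := by
      rcases hk.eq_or_lt with h | h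
      · exact .inl h.symm
      · exact .inr ⟨k - 3, by omega⟩
    · exact (le_of_defect_two hsymm hnonneg hskew hone hδ1 (hn1 1) (hn2 1) hδ0).trans htarget
    by_cases hsmall : ∃ j, 1 ≤ j ∧ j ≤ k ∧ bddInner μ 1 ((kernelOp μ N ^ j) 1) ≤ 1 / 2
    · obtain ⟨j, hj1, hjk, hj⟩ := hsmall
      have h := ih (k + 2 - j) (by omega) (by omega)
      have h2 := hsub j (k + 2 - j) hj
      rw [show j + 1 + (k + 2 - j) = k + 3 by omega] at h2
      exact h2.trans h
    push Not at hsmall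
    have hδ : bddInner μ e 1 ≤ 1 / 2 ∨ bddInner μ 1 ((kernelOp μ N ^ (k + 3)) 1) ≤ 1 / 2 := by
      by_contra! hcon
      have hn : bddInner μ 1 ((kernelOp μ N ^ 1) 1) ≤ 1 / 2 := by linarith [hcon.1]
      rcases Nat.eq_zero_or_pos k with rfl | hkp
      · linarith [hsub 1 1 hn, hcon.2]
      · linarith [hsmall 1 le_rfl hkp]
    rcases hδ with hδ | hδ
    · refine (le_of_defect hsymm hnonneg hskew hnorm hone hδ0 hδ
        (neg_le_bddInner_kernelOp μ ha1 (kernelOp_nonneg μ hE0 fun _ => zero_le_one)) k ?_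
        (hn0 _) (hn1 _) (hn2 _)).trans htarget
      intro j hj
      rcases Nat.eq_zero_or_pos j with rfl | hjp
      · rw [pow_zero, Module.End.one_apply, hone]; norm_num
      · exact (hsmall j hjp hj).le.trans (hn0 j)
    · exact hδ.trans hhalf

end WalkDensity

section PathIntegral

variable {Ω : Type*} [MeasurableSpace Ω] (μ : Measure Ω) [IsProbabilityMeasure μ]

lemma integral_walk_eq (F : BddMeas (Ω × Ω)) (k : ℕ) (u : BddMeas Ω) :
    ∫ x : Fin (k + 1) → Ω, (u : Ω → ℝ) (x 0) *
      ∏ i : Fin k, (F : Ω × Ω → ℝ) (x i.castSucc, x i.succ) ∂(Measure.pi fun _ => μ) =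
    bddInner μ 1 ((kernelOp μ F ^ k) u) := by
  induction k generalizing u with
  | zero =>
    rw [bddInner_one_left]
    simpa using integral_comp_eval (μ := fun _ : Fin 1 => μ) (i := 0)
      u.measurable.aestronglyMeasurable
  | succ k ih =>
    rw [pow_succ, Module.End.mul_apply, ← ih]
    have hmp := (measurePreserving_piFinSuccAbove (fun _ : Fin (k + 2) => μ) 0).symm
    rw [← hmp.integral_comp' ]
    let w : BddMeas (Ω × (Fin (k + 1) → Ω)) :=
      u.comp Prod.fst measurable_fst * F.comp (fun p : Ω × (Fin (k + 1) → Ω) => (p.1, p.2 0)) (by fun_prop) *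
        ∏ i : Fin k, F.comp (fun p : Ω × (Fin (k + 1) → Ω) => (p.2 i.castSucc, p.2 i.succ)) (by fun_prop)
    have hw : ∀ p, (w : Ω × (Fin (k + 1) → Ω) → ℝ) p = (u : Ω → ℝ) p.1 *
        (F : Ω × Ω → ℝ) (p.1, p.2 0) *
        ∏ i : Fin k, (F : Ω × Ω → ℝ) (p.2 i.castSucc, p.2 i.succ) := by
      intro p
      simp [w, Finset.prod_apply]
    calc _ = ∫ p, (w : Ω × (Fin (k + 1) → Ω) → ℝ) p ∂(μ.prod (Measure.pi fun _ => μ)) := by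
          refine integral_congr_ae (.of_forall fun p => ?_)
          simp only [hw, MeasurableEquiv.piFinSuccAbove_symm_apply, Fin.prod_univ_succ,
            Fin.insertNthEquiv_zero, Fin.consEquiv_apply, Fin.cons_zero, Fin.castSucc_zero,
            Fin.cons_succ, ← Fin.succ_castSucc, mul_assoc]
      _ = _ := by
          rw [integral_prod_symm _ (BddMeas.integrable _ _)]
          refine integral_congr_ae (.of_forall fun x => ?_)
          simp only [hw, kernelOp_apply]
          rw [integral_mul_const]
          simp only [mul_comm]

lemma measurePreserving_eval_pair {ι : Type*} [Fintype ι] {i j : ι} (hij : i ≠ j) :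
    MeasurePreserving (fun x : ι → Ω => (x i, x j)) (Measure.pi fun _ => μ) (μ.prod μ) := by
  refine ⟨by fun_prop, ?_⟩
  have h : ProbabilityTheory.IndepFun (fun x : ι → Ω => x i) (fun x => x j)
      (Measure.pi fun _ => μ) :=
    (ProbabilityTheory.iIndepFun_pi (μ := fun _ : ι => μ) (X := fun _ => id)
      (fun _ => aemeasurable_id)).indepFun hij
  rw [ProbabilityTheory.indepFun_iff_map_prod_eq_prod_map_map
    (measurable_pi_apply i).aemeasurable (measurable_pi_apply j).aemeasurable] at h
  have hi := (measurePreserving_eval (fun _ : ι => μ) i).map_eq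
  have hj := (measurePreserving_eval (fun _ : ι => μ) j).map_eq
  rw [h]
  exact congrArg₂ _ hi hj

/-- An a.e. constrained kernel agrees a.e. with one satisfying the constraints everywhere. -/
lemma exists_bddMeas_ae_eq {f : Ω → Ω → ℝ}
    (hf : AEStronglyMeasurable (fun p : Ω × Ω => f p.1 p.2) (μ.prod μ))
    (h0 : ∀ᵐ p ∂(μ.prod μ), 0 ≤ f p.1 p.2)
    (h1 : ∀ᵐ p ∂(μ.prod μ), f p.1 p.2 + f p.2 p.1 ≤ 1) :
    ∃ F : BddMeas (Ω × Ω), (∀ p, 0 ≤ (F : Ω × Ω → ℝ) p) ∧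
      (∀ p, (F : Ω × Ω → ℝ) p + (F : Ω × Ω → ℝ) p.swap ≤ 1) ∧
      ∀ᵐ p ∂(μ.prod μ), (F : Ω × Ω → ℝ) p = f p.1 p.2 := by
  classical
  set h := hf.mk _ with hh
  have hm : Measurable h := hf.stronglyMeasurable_mk.measurable
  have hae : ∀ᵐ p ∂(μ.prod μ), f p.1 p.2 = h p := hf.ae_eq_mk
  have hswap : MeasurePreserving (Prod.swap : Ω × Ω → Ω × Ω) (μ.prod μ) (μ.prod μ) :=
    Measure.measurePreserving_swap
  have hae' := hswap.quasiMeasurePreserving.ae hae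
  have h0' := hswap.quasiMeasurePreserving.ae h0
  set S : Set (Ω × Ω) := {p | 0 ≤ h p ∧ 0 ≤ h p.swap ∧ h p + h p.swap ≤ 1} with hS
  have hSm : MeasurableSet S :=
    (measurableSet_le measurable_const hm).inter
      ((measurableSet_le measurable_const (hm.comp measurable_swap)).inter
        (measurableSet_le (hm.add (hm.comp measurable_swap)) measurable_const))
  have hSs : ∀ p, p.swap ∈ S ↔ p ∈ S := fun p => by
    simp only [hS, Set.mem_ofPred_eq, Prod.swap_swap, add_comm (h p.swap)]
    tauto
  have hF0 : ∀ p, 0 ≤ S.indicator h p := fun p => Set.indicator_nonneg (fun p hp => hp.1) p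
  have hF1 : ∀ p, S.indicator h p + S.indicator h p.swap ≤ 1 := fun p => by
    by_cases hp : p ∈ S
    · rw [Set.indicator_of_mem hp, Set.indicator_of_mem ((hSs p).2 hp)]
      exact hp.2.2
    · rw [Set.indicator_of_notMem hp, Set.indicator_of_notMem (mt (hSs p).1 hp)]
      norm_num
  refine ⟨⟨S.indicator h, hm.indicator hSm, 1, fun p => ?_⟩, hF0, hF1, ?_⟩
  · rw [abs_of_nonneg (hF0 p)]
    linarith [hF1 p, hF0 p.swap]
  · filter_upwards [hae, hae', h0, h0', h1] with p e1 e2 e3 e4 e5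
    simp only [Prod.fst_swap, Prod.snd_swap] at e2 e4
    have hp : p ∈ S := ⟨e1 ▸ e3, e2 ▸ e4, by rw [← e1, ← e2]; exact e5⟩
    change S.indicator h p = _
    rw [Set.indicator_of_mem hp, e1]

end PathIntegral

theorem stability_graphon (f : ℝ → ℝ → ℝ)
    (hint : IntegrableOn (fun p : ℝ × ℝ => f p.1 p.2)
      (Set.Icc (0:ℝ) 1 ×ˢ Set.Icc (0:ℝ) 1))
    (hrange : ∀ x ∈ Set.Icc (0:ℝ) 1, ∀ y ∈ Set.Icc (0:ℝ) 1, f x y ∈ Set.Icc (0:ℝ) 1)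
    (hanti : ∀ x ∈ Set.Icc (0:ℝ) 1, ∀ y ∈ Set.Icc (0:ℝ) 1, f x y + f y x ≤ 1)
    (ε : ℝ) (hε : 0 ≤ ε)
    (hdev : ε ≤ ∫ y in Set.Icc (0:ℝ) 1, |(∫ x in Set.Icc (0:ℝ) 1, f x y) - 1/2|)
    (k : ℕ) (hk : 2 ≤ k) :
    (∫ x in Set.univ.pi (fun _ : Fin (k+1) => Set.Icc (0:ℝ) 1),
      ∏ i : Fin k, f (x i.castSucc) (x i.succ)) ≤ (1/2 : ℝ) ^ k * (1 - 2 * ε^2) := by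
  set μ : Measure ℝ := volume.restrict (Set.Icc (0 : ℝ) 1) with hμ
  have hprob : IsProbabilityMeasure μ := ⟨by simp [hμ]⟩
  have hprod : (volume : Measure (ℝ × ℝ)).restrict (Set.Icc (0:ℝ) 1 ×ˢ Set.Icc (0:ℝ) 1) =
      μ.prod μ := by
    rw [hμ, Measure.prod_restrict, Measure.volume_eq_prod]
  have hsq : ∀ᵐ p ∂(μ.prod μ), p ∈ Set.Icc (0:ℝ) 1 ×ˢ Set.Icc (0:ℝ) 1 := by
    rw [← hprod]
    exact ae_restrict_mem (measurableSet_Icc.prod measurableSet_Icc)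
  obtain ⟨F, hF0, hF1, hFf⟩ := exists_bddMeas_ae_eq μ (f := f)
    (hprod ▸ hint.aestronglyMeasurable)
    (hsq.mono fun p hp => (hrange p.1 hp.1 p.2 hp.2).1)
    (hsq.mono fun p hp => hanti p.1 hp.1 p.2 hp.2)
  have hpi : (volume : Measure (Fin (k + 1) → ℝ)).restrict
      (Set.univ.pi fun _ => Set.Icc (0:ℝ) 1) = Measure.pi fun _ => μ := by
    rw [volume_pi, Measure.restrict_pi_pi]
  have hdevF : ε ≤ ∫ y, |(∫ x, (F : ℝ × ℝ → ℝ) (x, y) ∂μ) - 1 / 2| ∂μ := by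
    refine hdev.trans_eq (integral_congr_ae ?_)
    have h := Measure.ae_ae_of_ae_prod
      (Measure.measurePreserving_swap (μ := μ) (ν := μ) |>.quasiMeasurePreserving.ae hFf)
    filter_upwards [h] with y hy
    have hy' : ∫ x, (F : ℝ × ℝ → ℝ) (x, y) ∂μ = ∫ x, f x y ∂μ := integral_congr_ae hy
    simp only [hy']
  have hpath : ∫ x, ∏ i : Fin k, f (x i.castSucc) (x i.succ) ∂(Measure.pi fun _ => μ) =
      bddInner μ 1 ((kernelOp μ F ^ k) 1) := by
    rw [← integral_walk_eq]
    have h : ∀ᵐ x ∂(Measure.pi fun _ : Fin (k + 1) => μ), ∀ i : Fin k,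
        (F : ℝ × ℝ → ℝ) (x i.castSucc, x i.succ) = f (x i.castSucc) (x i.succ) :=
      ae_all_iff.2 fun i => (measurePreserving_eval_pair μ
        (Fin.castSucc_lt_succ (i := i)).ne).quasiMeasurePreserving.ae hFf
    refine integral_congr_ae ?_
    filter_upwards [h] with x hx
    simp [hx]
  rw [hpi, hpath]
  have hmain := walkDensity_stability μ hF0 hF1 hε hdevF k hk
  rw [map_smul, smul_pow, LinearMap.smul_apply, map_smul, smul_eq_mul] at hmain
  have h2 : (1 / 2 : ℝ) ^ k * 2 ^ k = 1 := by rw [← mul_pow]; norm_num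
  calc _ = (1 / 2 : ℝ) ^ k * (2 ^ k * bddInner μ 1 ((kernelOp μ F ^ k) 1)) := by
        rw [← mul_assoc, h2, one_mul]
    _ ≤ _ := mul_le_mul_of_nonneg_left hmain (by positivity)
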